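/- arXiv:1705.08067 — 2 statements merged into one kernel-verified Lean document; each statement's English description precedes it below -/
import Mathlib

section
/- Let w ≥ 1, let z_1,…,z_w be complex numbers, let p ∈ ℕ, a_p ∈ ℂ with a_p ≠ 0, and let n ≥ 1. Then for every r, s ∈ {1,…,n}, the (r,s) entry of the adjugate matrix satisfies adj(T_n(a))_{r,s} = (−1)^{p(n−1)} · a_p^{n−1} · s_{((n−1)^p, s−1)/(r−1)}(z_1,…,z_w), where the outer partition is ((n−1) repeated p times, then s−1) and the inner partition is the single part (r−1). -/
open scoped BigOperators

/-- The `r`-th elementary symmetric polynomial in `w` variables, evaluated at `z`,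
extended by `0` to negative integer indices (and automatically `0` for `r > w`). -/
noncomputable def eInt (w : ℕ) (z : Fin w → ℂ) (r : ℤ) : ℂ :=
  if 0 ≤ r then
    ∑ s ∈ Finset.powersetCard r.toNat (Finset.univ : Finset (Fin w)), ∏ i ∈ s, z i
  else 0

/-- The `r`-th complete homogeneous symmetric polynomial in `w` variables, evaluated at `z`,
extended by `0` to negative integer indices. -/
noncomputable def hInt (w : ℕ) (z : Fin w → ℂ) (r : ℤ) : ℂ :=
  if 0 ≤ r then ∑ m : Sym (Fin w) r.toNat, (m.1.map z).prod else 0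

/-- Skew Schur polynomial via the Jacobi–Trudi determinant
`s_{λ/μ} = det [h_{λ_j - μ_k - j + k}]_{j,k=1}^{ℓ}`,
where the parts are given as `1`-based integer sequences `lam`, `mu`. -/
noncomputable def skewSchur (w : ℕ) (z : Fin w → ℂ) (ℓ : ℕ) (lam mu : ℕ → ℤ) : ℂ :=
  Matrix.det (Matrix.of fun j k : Fin ℓ =>
    hInt w z (lam (j.1 + 1) - mu (k.1 + 1) - ((j.1 : ℤ) + 1) + ((k.1 : ℤ) + 1)))

/-- Schur polynomial `s_λ`. -/
noncomputable def schur (w : ℕ) (z : Fin w → ℂ) (ℓ : ℕ) (lam : ℕ → ℤ) : ℂ :=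
  skewSchur w z ℓ lam (fun _ => 0)

/-- Coefficients of the Laurent polynomial `a(t) = a_p t^(p-w) ∏_{j=1}^w (t - z_j)`,
namely `a_k = (-1)^(p-k) * a_p * e_{p-k}(z_1,…,z_w)`. -/
noncomputable def aCoeff (w p : ℕ) (ap : ℂ) (z : Fin w → ℂ) (k : ℤ) : ℂ :=
  (-1 : ℂ) ^ ((p : ℤ) - k) * ap * eInt w z ((p : ℤ) - k)

/-- The `n × n` Toeplitz matrix `[a_{j-k}]_{j,k=1}^n` with coefficient sequence `a`. -/
noncomputable def toeplitz (n : ℕ) (a : ℤ → ℂ) : Matrix (Fin n) (Fin n) ℂ :=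
  Matrix.of fun j k => a ((j.1 : ℤ) - (k.1 : ℤ))
open Matrix PowerSeries

/-- The coefficients of a power series, extended by `0` to negative integer indices. -/
noncomputable def PowerSeries.coeffInt {R : Type*} [Semiring R] (f : PowerSeries R) (m : ℤ) : R :=
  if 0 ≤ m then coeff m.toNat f else 0

lemma PowerSeries.coeffInt_natCast {R : Type*} [Semiring R] (f : PowerSeries R) (m : ℕ) :
    f.coeffInt m = coeff m f := by
  simp [coeffInt]

lemma PowerSeries.coeffInt_of_neg {R : Type*} [Semiring R] (f : PowerSeries R) {m : ℤ}
    (hm : m < 0) : f.coeffInt m = 0 := by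
  simp [coeffInt, hm.not_ge]

lemma PowerSeries.sum_coeffInt_mul_coeffInt {R : Type*} [Semiring R] (f g : PowerSeries R)
    {N : ℕ} (i j : Fin N) :
    ∑ k : Fin N, f.coeffInt ((k : ℤ) - (i : ℤ)) * g.coeffInt ((j : ℤ) - (k : ℤ))
      = (f * g).coeffInt ((j : ℤ) - (i : ℤ)) := by
  rw [Fin.sum_univ_eq_sum_range
    (fun k : ℕ => f.coeffInt ((k : ℤ) - (i : ℤ)) * g.coeffInt ((j : ℤ) - (k : ℤ)))]
  have hzero : ∀ k : ℕ, ¬ ((i : ℕ) ≤ k ∧ k ≤ j) →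
      f.coeffInt ((k : ℤ) - (i : ℤ)) * g.coeffInt ((j : ℤ) - (k : ℤ)) = 0 := by
    intro k hk
    rcases not_and_or.mp hk with h | h
    · rw [coeffInt_of_neg f (by omega), zero_mul]
    · rw [coeffInt_of_neg g (by omega), mul_zero]
  rcases le_or_gt (i : ℕ) (j : ℕ) with hij | hij
  · obtain ⟨d, hd⟩ := Nat.exists_eq_add_of_le hij
    have hsub : Finset.Ico (i : ℕ) (j + 1) ⊆ Finset.range N := by
      intro k hk
      have := j.isLt
      simp only [Finset.mem_Ico, Finset.mem_range] at hk ⊢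
      omega
    rw [← Finset.sum_subset hsub fun k _ hk => hzero k fun h => hk (by
      simp only [Finset.mem_Ico]; omega), Finset.sum_Ico_eq_sum_range,
      show ((j : ℤ) - (i : ℤ)) = (d : ℕ) by omega, coeffInt_natCast, coeff_mul,
      Finset.Nat.sum_antidiagonal_eq_sum_range_succ (fun a b => coeff a f * coeff b g),
      show (j : ℕ) + 1 - i = d + 1 by omega]
    refine Finset.sum_congr rfl fun t ht => ?_
    have ht := Finset.mem_range.mp ht
    rw [show (((i + t : ℕ) : ℤ) - (i : ℤ)) = (t : ℕ) by omega,
      show ((j : ℤ) - ((i + t : ℕ) : ℤ)) = (d - t : ℕ) by omega, coeffInt_natCast,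
      coeffInt_natCast]
  · rw [coeffInt_of_neg _ (by omega)]
    exact Finset.sum_eq_zero fun k _ => hzero k (by omega)

lemma PowerSeries.mk_pow_mul_one_sub {R : Type*} [CommRing R] (a : R) :
    (1 - C a * X) * mk (fun n => a ^ n) = 1 := by
  ext n
  cases n with
  | zero => simp [sub_mul, mul_assoc]
  | succ n => simp [sub_mul, mul_assoc, pow_succ']

/-- The generating function of the signed elementary symmetric polynomials. -/
lemma neg_one_zpow_mul_eInt (w : ℕ) (z : Fin w → ℂ) (m : ℤ) :
    (-1 : ℂ) ^ m * eInt w z m = (∏ i, (1 - C (z i) * X) : PowerSeries ℂ).coeffInt m := by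
  rcases lt_or_ge m 0 with hm | hm
  · simp [eInt, coeffInt_of_neg _ hm, hm.not_ge]
  lift m to ℕ using hm
  simp only [coeffInt_natCast, sub_eq_add_neg, Finset.prod_one_add, map_sum, eInt,
    Int.natCast_nonneg, if_true, Int.toNat_natCast, zpow_natCast]
  rw [Finset.powersetCard_eq_filter, Finset.sum_filter, Finset.mul_sum]
  refine Finset.sum_congr rfl fun t _ => ?_
  have h : (∏ i ∈ t, -(C (z i) * X) : PowerSeries ℂ)
      = C ((-1) ^ t.card * ∏ i ∈ t, z i) * X ^ t.card := by
    rw [Finset.prod_neg, Finset.prod_mul_distrib, Finset.prod_const]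
    simp [mul_assoc]
  rw [h, coeff_C_mul, coeff_X_pow]
  by_cases hc : m = t.card <;> simp [hc, eq_comm]

/-- The generating function of the complete homogeneous symmetric polynomials. -/
lemma hInt_eq_coeffInt (w : ℕ) (z : Fin w → ℂ) (m : ℤ) :
    hInt w z m = (∏ i, mk (fun n => z i ^ n) : PowerSeries ℂ).coeffInt m := by
  rcases lt_or_ge m 0 with hm | hm
  · simp [hInt, coeffInt_of_neg _ hm, hm.not_ge]
  lift m to ℕ using hm
  simp only [coeffInt_natCast, coeff_prod, coeff_mk, hInt, Int.natCast_nonneg, if_true,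
    Int.toNat_natCast]
  refine Finset.sum_bij' (fun s _ => (Sym.equivNatSum (Fin w) m s : Fin w →₀ ℕ))
    (fun l hl => (Sym.equivNatSum (Fin w) m).symm ⟨l, ?_⟩) ?_ ?_ ?_ ?_ ?_
  · exact (Finset.mem_finsuppAntidiag'.mp hl).1
  · intro s _
    exact Finset.mem_finsuppAntidiag'.mpr ⟨(Sym.equivNatSum (Fin w) m s).2, Finset.subset_univ _⟩
  · simp
  · simp
  · simp
  · intro s _
    simp only [Sym.coe_equivNatSum_apply_apply]
    rw [Finset.prod_multiset_map_count]
    exact Finset.prod_subset (Finset.subset_univ _) fun i _ hi => by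
      simp_all

/-- The upper triangular Toeplitz matrix attached to a power series. -/
noncomputable def upperToeplitz {R : Type*} [Semiring R] (N : ℕ) (f : PowerSeries R) :
    Matrix (Fin N) (Fin N) R :=
  of fun i j => f.coeffInt ((j : ℤ) - (i : ℤ))

lemma upperToeplitz_mul {R : Type*} [Semiring R] (N : ℕ) (f g : PowerSeries R) :
    upperToeplitz N f * upperToeplitz N g = upperToeplitz N (f * g) := by
  ext i j
  exact sum_coeffInt_mul_coeffInt f g i j

lemma upperToeplitz_one {R : Type*} [Semiring R] (N : ℕ) :
    upperToeplitz N (1 : PowerSeries R) = 1 := by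
  ext i j
  simp only [upperToeplitz, of_apply, coeffInt, coeff_one, one_apply, Fin.ext_iff]
  split_ifs <;> first | rfl | omega

lemma det_upperToeplitz {R : Type*} [CommRing R] (N : ℕ) (f : PowerSeries R) :
    (upperToeplitz N f).det = coeff 0 f ^ N := by
  rw [det_of_isUpperTriangular]
  · simp [upperToeplitz, coeffInt]
  · intro i j hij
    exact coeffInt_of_neg f (by simp only [id] at hij; omega)

/-- The cofactor form of Jacobi's complementary minor identity. -/
lemma adjugate_toBlocks₁₁_apply {R ι κ : Type*} [CommRing R] [Fintype ι] [DecidableEq ι]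
    [Fintype κ] [DecidableEq κ] (U V : Matrix (ι ⊕ κ) (ι ⊕ κ) R) (h : U * V = 1) (r s : ι) :
    adjugate U.toBlocks₁₁ r s = U.det *
      (V.submatrix (fun i : Option κ => i.elim (Sum.inl r) Sum.inr)
        (fun j : Option κ => j.elim (Sum.inl s) Sum.inr)).det := by
  set Y : Matrix (ι ⊕ κ) (ι ⊕ κ) R := of fun i j =>
    Sum.elim (fun q => if q = r then V i (Sum.inl s) else (1 : Matrix (ι ⊕ κ) (ι ⊕ κ) R) i (Sum.inl q))
      (fun c => V i (Sum.inr c)) j with hY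
  have hUY : U * Y = fromBlocks (U.toBlocks₁₁.updateCol r (Pi.single s 1)) 0
      (U.toBlocks₂₁.updateCol r 0) 1 := by
    have hV : ∀ i j, ∑ k, U i k * V k j = (1 : Matrix (ι ⊕ κ) (ι ⊕ κ) R) i j := fun i j => by
      rw [← h, mul_apply]
    ext i j
    rw [mul_apply]
    rcases j with q | c
    · by_cases hq : q = r
      · subst hq
        rcases i with i | i <;> simp [hY, hV, one_apply, Pi.single_apply, -Fintype.sum_sum_type]
      · rcases i with i | i <;>
          simp [hY, hq, one_apply, -Fintype.sum_sum_type, toBlocks₁₁, toBlocks₂₁]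
    · rcases i with i | i <;> simp [hY, hV, one_apply, -Fintype.sum_sum_type]
  have hadj : adjugate U.toBlocks₁₁ r s = (U * Y).det := by
    rw [hUY, det_fromBlocks_zero₁₂, det_one, mul_one, ← transpose_apply (adjugate _),
      adjugate_transpose, adjugate_apply, updateRow_transpose, det_transpose]
  set φ : Option κ → ι ⊕ κ := fun i => i.elim (Sum.inl r) Sum.inr with hφ
  have hφinj : Function.Injective φ := by
    rintro (_ | a) (_ | b) hab <;> simp_all
  have hcol : ∀ j, j ∉ Set.range φ → ∃ q, q ≠ r ∧ j = Sum.inl q := by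
    rintro (q | c) hj
    · exact ⟨q, fun hq => hj ⟨none, by simp [hφ, hq]⟩, rfl⟩
    · exact absurd ⟨some c, rfl⟩ hj
  classical
  rw [hadj, det_mul, twoBlockTriangular_det' Y (· ∈ Set.range φ)]
  · have hone : toSquareBlockProp Y (fun x => x ∉ Set.range φ) = 1 := by
      ext ⟨i, hi⟩ ⟨j, hj⟩
      obtain ⟨q, hq, rfl⟩ := hcol j hj
      simp [toSquareBlockProp_def, hY, hq, one_apply]
    have hsub : V.submatrix φ (fun j : Option κ => j.elim (Sum.inl s) Sum.inr)
        = (toSquareBlockProp Y (· ∈ Set.range φ)).submatrix (Equiv.ofInjective φ hφinj)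
          (Equiv.ofInjective φ hφinj) := by
      ext i j
      rcases j with _ | c <;> simp [toSquareBlockProp_def, hY, hφ]
    rw [hone, det_one, mul_one, hsub, det_submatrix_equiv_self]
    congr!
  · intro i hi j hj
    obtain ⟨q, hq, rfl⟩ := hcol j hj
    have : i ≠ Sum.inl q := fun h => hj (h ▸ hi)
    simp [hY, hq, this]

/-- Moving the last `p` of `n + p` indices to the front is a permutation of sign `(-1)^(p * n)`. -/
lemma sign_finAddFlip_trans_finCongr (n p : ℕ) :
    Equiv.Perm.sign (finAddFlip.trans (finCongr (Nat.add_comm p n)) : Equiv.Perm (Fin (n + p)))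
      = (-1) ^ (p * n) := by
  have hpow : ∀ (N q : ℕ) (i : Fin N), ((finRotate N ^ q) i : ℕ) = (i + q) % N := by
    intro N q i
    have := i.neZero
    induction q with
    | zero => simp [Nat.mod_eq_of_lt i.isLt]
    | succ q ih =>
      rw [pow_succ', Equiv.Perm.mul_apply, finRotate_apply, Fin.val_add, ih, Fin.val_one']
      simp [Nat.add_assoc]
  have hrot : (finAddFlip.trans (finCongr (Nat.add_comm p n)) : Equiv.Perm (Fin (n + p)))
      = finRotate (n + p) ^ p := by
    ext i
    rw [hpow]
    induction i using Fin.addCases with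
    | left i =>
      have := i.isLt
      simp only [Equiv.trans_apply, finAddFlip_apply_castAdd, finCongr_apply, Fin.val_cast,
        Fin.val_natAdd, Fin.val_castAdd]
      rw [Nat.mod_eq_of_lt (by omega), Nat.add_comm]
    | right i =>
      have := i.isLt
      simp only [Equiv.trans_apply, finAddFlip_apply_natAdd, finCongr_apply, Fin.val_cast,
        Fin.val_castAdd, Fin.val_natAdd]
      rw [show n + (i : ℕ) + p = i + (n + p) by omega, Nat.add_mod_right,
        Nat.mod_eq_of_lt (by omega)]
  rw [hrot, map_pow, sign_finRotate, ← pow_mul]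
  rcases p with _ | p
  · simp
  · rw [← Nat.add_assoc, Nat.add_sub_cancel]
    have : (n + p) * (p + 1) = (p + 1) * n + p * (p + 1) := by ring
    rw [this, pow_add, (Nat.even_mul_succ_self p).neg_one_pow, mul_one]

/-- Theorem 2, formula (eq:adj_through_skew_Schur):
`adj(T_n(a))_{r,s} = (-1)^{p(n-1)} a_p^{n-1} s_{((n-1)^p, s-1)/(r-1)}`. -/
theorem toeplitz_adjugate_eq_skewSchur
    (w : ℕ) (hw : 1 ≤ w) (z : Fin w → ℂ) (p : ℕ) (ap : ℂ) (hap : ap ≠ 0)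
    (n : ℕ) (hn : 1 ≤ n) (r s : ℕ) (hr : 1 ≤ r) (hrn : r ≤ n) (hs : 1 ≤ s) (hsn : s ≤ n) :
    Matrix.adjugate (toeplitz n (aCoeff w p ap z)) ⟨r - 1, by omega⟩ ⟨s - 1, by omega⟩
      = (-1 : ℂ) ^ (p * (n - 1)) * ap ^ (n - 1)
        * skewSchur w z (p + 1)
            (fun j => if j ≤ p then (n : ℤ) - 1 else (s : ℤ) - 1)
            (fun k => if k = 1 then (r : ℤ) - 1 else 0) := by
  set f : PowerSeries ℂ := ∏ i, (1 - C (z i) * X) with hf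
  set g : PowerSeries ℂ := ∏ i, mk (fun n => z i ^ n) with hg
  have hfg : f * g = 1 := by
    rw [hf, hg, ← Finset.prod_mul_distrib]
    exact Finset.prod_eq_one fun i _ => mk_pow_mul_one_sub (z i)
  set τ : Equiv.Perm (Fin (n + p)) := finAddFlip.trans (finCongr (Nat.add_comm p n)) with hτ
  set e : Fin n ⊕ Fin p ≃ Fin (n + p) := finSumFinEquiv with he
  set U : Matrix (Fin n ⊕ Fin p) (Fin n ⊕ Fin p) ℂ :=
    ((upperToeplitz (n + p) f).submatrix id τ).submatrix e e with hU
  set V : Matrix (Fin n ⊕ Fin p) (Fin n ⊕ Fin p) ℂ :=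
    ((upperToeplitz (n + p) g).submatrix τ id).submatrix e e with hV
  have hUV : U * V = 1 := by
    rw [hU, hV, submatrix_mul_equiv, submatrix_mul_equiv, upperToeplitz_mul, hfg,
      upperToeplitz_one]
    simp
  have hdetU : U.det = (-1) ^ (p * n) := by
    have hf0 : coeff 0 f = 1 := by simp [hf]
    rw [hU, det_submatrix_equiv_self, det_permute', hτ, sign_finAddFlip_trans_finCongr,
      det_upperToeplitz, hf0]
    simp
  have hT : toeplitz n (aCoeff w p ap z) = ap • U.toBlocks₁₁ := by
    ext i j
    simp only [toeplitz, aCoeff, of_apply, Matrix.smul_apply, smul_eq_mul]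
    rw [mul_right_comm, neg_one_zpow_mul_eInt, mul_comm]
    congr 1
    simp only [hU, hτ, he, toBlocks₁₁, upperToeplitz, of_apply, submatrix_apply,
      finSumFinEquiv_apply_left, id, Equiv.trans_apply, finAddFlip_apply_castAdd, finCongr_apply,
      Fin.val_cast, Fin.val_natAdd, Fin.val_castAdd]
    congr 1
    push_cast
    ring
  set W := V.submatrix (fun i : Option (Fin p) => i.elim (Sum.inl ⟨r - 1, by omega⟩) Sum.inr)
    (fun j : Option (Fin p) => j.elim (Sum.inl ⟨s - 1, by omega⟩) Sum.inr) with hW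
  set ε : Fin (p + 1) ≃ Option (Fin p) := Fin.revPerm.trans (finSuccEquiv p) with hε
  have hS : skewSchur w z (p + 1)
      (fun j => if j ≤ p then (n : ℤ) - 1 else (s : ℤ) - 1)
      (fun k => if k = 1 then (r : ℤ) - 1 else 0) = (-1) ^ p * W.det := by
    have hsign : ((Equiv.Perm.sign (finRotate (p + 1)).symm : ℤˣ) : ℂ) = (-1) ^ p := by
      rw [Equiv.Perm.sign_symm, sign_finRotate]
      simp
    rw [← hsign, ← det_submatrix_equiv_self ε, ← det_permute, skewSchur, ← det_transpose]
    congr 1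
    ext k j
    rw [transpose_apply, of_apply, hInt_eq_coeffInt, ← hg, submatrix_apply, submatrix_apply]
    have hk : (ε ((finRotate (p + 1)).symm k) = none ∧ (k : ℕ) = 0) ∨
        ∃ i : Fin p, ε ((finRotate (p + 1)).symm k) = some i ∧ (k : ℕ) + i = p := by
      induction k using Fin.cases with
      | zero =>
        left
        have : (finRotate (p + 1)).symm 0 = Fin.last p := by
          rw [Equiv.symm_apply_eq, finRotate_last]
        simp only [this, hε, Equiv.trans_apply, Fin.revPerm_apply, Fin.rev_last,
          finSuccEquiv_zero, Fin.val_zero, and_self]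
      | succ k =>
        right
        have : (finRotate (p + 1)).symm k.succ = k.castSucc := by
          rw [Equiv.symm_apply_eq, finRotate_apply, Fin.coeSucc_eq_succ]
        refine ⟨k.rev, ?_, ?_⟩
        · simp only [this, hε, Equiv.trans_apply, Fin.revPerm_apply, Fin.rev_castSucc,
            finSuccEquiv_succ]
        · rw [Fin.val_rev, Fin.val_succ]
          omega
    have hj : (ε j = none ∧ (j : ℕ) = p) ∨ ∃ i : Fin p, ε j = some i ∧ (j : ℕ) + i + 1 = p := by
      induction j using Fin.lastCases with
      | last => exact Or.inl ⟨by simp [hε], Fin.val_last p⟩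
      | cast j =>
        refine Or.inr ⟨j.rev, by simp [hε, Fin.rev_castSucc], ?_⟩
        rw [Fin.val_rev, Fin.val_castSucc]
        omega
    rcases hk with ⟨hk, hk'⟩ | ⟨i, hk, hk'⟩ <;> rcases hj with ⟨hj, hj'⟩ | ⟨c, hj, hj'⟩ <;>
    · simp only [hk, hj, id, hW, hV, submatrix_apply, Option.elim_none, Option.elim_some, he, hτ,
        finSumFinEquiv_apply_left, finSumFinEquiv_apply_right, upperToeplitz, of_apply,
        Equiv.trans_apply, finAddFlip_apply_castAdd, finAddFlip_apply_natAdd, finCongr_apply,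
        Fin.val_cast, Fin.val_natAdd, Fin.val_castAdd]
      congr 1
      split_ifs <;> omega
  rw [hT, adjugate_smul, Matrix.smul_apply, adjugate_toBlocks₁₁_apply U V hUV, hdetU, hS, ← hW,
    Fintype.card_fin, smul_eq_mul]
  obtain ⟨m, rfl⟩ := Nat.exists_eq_add_of_le' hn
  rw [Nat.add_sub_cancel, Nat.mul_succ, pow_add]
  ring
end

section
/- Let w ≥ 1, let z_1,…,z_w be complex numbers, let p ∈ ℕ, a_p ∈ ℂ with a_p ≠ 0, and let n ≥ 1. Then for every r, s ∈ {1,…,n}, adj(T_n(a))_{r,s} = (−1)^{pn} · a_p^{n−1} · ( h_{s−r−p} · s_{(n^p)}(z_1,…,z_w) − Σ_{k=0}^{p−1} (−1)^k · h_{s+k−p} · s_{(n^{p−k−1}, (n−1)^k, n−r)}(z_1,…,z_w) ), where (n^{p−k−1}, (n−1)^k, n−r) denotes the partition with n repeated p−k−1 times, then n−1 repeated k times, then the part n−r. -/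
open scoped BigOperators

open Matrix PowerSeries

theorem coeff_prod_one_sub_C_mul_X (w : ℕ) (z : Fin w → ℂ) (d : ℕ) :
    coeff d (∏ i, (1 - C (z i) * X : PowerSeries ℂ)) = (-1) ^ d * eInt w z d := by
  have h (t : Finset (Fin w)) : ∏ i ∈ t, (-(C (z i) * X) : PowerSeries ℂ)
      = C ((-1) ^ t.card * ∏ i ∈ t, z i) * X ^ t.card := by
    simp [Finset.prod_neg, Finset.prod_mul_distrib, mul_assoc]
  simp only [sub_eq_add_neg, Finset.prod_one_add, h, map_sum, coeff_C_mul, coeff_X_pow, eInt,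
    Nat.cast_nonneg, if_true, Int.toNat_natCast, mul_ite, mul_one, mul_zero, ← Finset.sum_filter,
    Finset.mul_sum]
  refine Finset.sum_congr (by ext; simp [Finset.mem_powersetCard, eq_comm]) fun t ht => ?_
  rw [(Finset.mem_powersetCard.1 ht).2]

theorem coeff_prod_geometric (w : ℕ) (z : Fin w → ℂ) (d : ℕ) :
    coeff d (∏ i, PowerSeries.mk fun m => z i ^ m) = hInt w z d := by
  simp only [coeff_prod, coeff_mk, hInt, Nat.cast_nonneg, if_true, Int.toNat_natCast]
  refine (Finset.sum_bij' (fun m _ => (Sym.equivNatSum (Fin w) d m : Fin w →₀ ℕ))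
    (fun l hl => (Sym.equivNatSum (Fin w) d).symm ⟨l, ?_⟩) ?_ ?_ ?_ ?_ ?_).symm
  · simpa [Finsupp.sum_fintype] using hl
  · intro m _
    have := (Sym.equivNatSum (Fin w) d m).2
    exact Finset.mem_finsuppAntidiag.2
      ⟨(Finsupp.sum_fintype _ _ (by simp)).symm.trans this, Finset.subset_univ _⟩
  · simp
  · simp
  · simp
  · intro m _
    simp only [Finset.prod_multiset_map_count, Sym.val_eq_coe, Sym.coe_equivNatSum_apply_apply]
    exact Finset.prod_subset (Finset.subset_univ _) (by simp +contextual)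

theorem prod_one_sub_mul_prod_geometric (w : ℕ) (z : Fin w → ℂ) :
    (∏ i, (1 - C (z i) * X : PowerSeries ℂ)) * (∏ i, PowerSeries.mk fun m => z i ^ m) = 1 := by
  rw [← Finset.prod_mul_distrib]
  refine Finset.prod_eq_one fun i _ => ?_
  ext d
  cases d <;> simp [sub_mul, mul_assoc, coeff_succ_X_mul, pow_succ', coeff_one]

/-- Convolution of two one-sided sequences on `ℤ` read off from a power series product. -/
theorem sum_range_mul_eq_coeff (f g : PowerSeries ℂ) (u v : ℤ → ℂ)
    (hu : ∀ d : ℕ, u d = coeff d f) (hv : ∀ d : ℕ, v d = coeff d g)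
    (hu' : ∀ d < 0, u d = 0) (hv' : ∀ d < 0, v d = 0) (N i j : ℕ) (hj : j < N) :
    ∑ k ∈ Finset.range N, u ((k : ℤ) - i) * v ((j : ℤ) - k)
      = if i ≤ j then coeff (j - i) (f * g) else 0 := by
  split_ifs with hij
  · rw [coeff_mul, Finset.Nat.sum_antidiagonal_eq_sum_range_succ_mk,
      ← Finset.sum_subset (s₁ := Finset.Ico i (j + 1)), Finset.sum_Ico_eq_sum_range]
    · refine Finset.sum_congr (by congr 1; omega) fun k hk => ?_
      rw [Finset.mem_range] at hk
      simp only [← hu, ← hv]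
      congr 2 <;> omega
    · intro k; simp only [Finset.mem_Ico, Finset.mem_range]; omega
    · intro k _ hk
      rw [Finset.mem_Ico] at hk
      by_cases h : i ≤ k
      · rw [hv' _ (by omega), mul_zero]
      · rw [hu' _ (by omega), zero_mul]
  · refine Finset.sum_eq_zero fun k _ => ?_
    by_cases h : i ≤ k
    · rw [hv' _ (by omega), mul_zero]
    · rw [hu' _ (by omega), zero_mul]

/-- The signed elementary symmetric polynomials `(-1)^d e_d`, extended by zero to `ℤ`. -/
noncomputable def signedE (w : ℕ) (z : Fin w → ℂ) (d : ℤ) : ℂ := (-1) ^ d * eInt w z d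

theorem signedE_of_neg (w : ℕ) (z : Fin w → ℂ) {d : ℤ} (hd : d < 0) : signedE w z d = 0 := by
  simp [signedE, eInt, hd]

theorem hInt_of_neg (w : ℕ) (z : Fin w → ℂ) {d : ℤ} (hd : d < 0) : hInt w z d = 0 := by
  simp [hInt, hd]

theorem signedE_zero (w : ℕ) (z : Fin w → ℂ) : signedE w z 0 = 1 := by
  simp [signedE, eInt]

theorem sum_range_signedE_mul_hInt (w : ℕ) (z : Fin w → ℂ) (N i j : ℕ) (hj : j < N) :
    ∑ k ∈ Finset.range N, signedE w z ((k : ℤ) - i) * hInt w z ((j : ℤ) - k)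
      = if i = j then 1 else 0 := by
  rw [sum_range_mul_eq_coeff _ _ (signedE w z) (hInt w z)
    (fun d => by rw [signedE, zpow_natCast]; exact (coeff_prod_one_sub_C_mul_X w z d).symm)
    (fun d => (coeff_prod_geometric w z d).symm) (fun _ => signedE_of_neg w z)
    (fun _ => hInt_of_neg w z) N i j hj, prod_one_sub_mul_prod_geometric, coeff_one]
  grind

section Blocks

variable {R m q : Type*} [CommRing R] [Fintype m] [Fintype q] [DecidableEq m] [DecidableEq q]

/-- **Jacobi's complementary minor identity** for a block matrix and its inverse. -/
theorem det_toBlocks₁₁_eq_of_mul_eq_one {U V : Matrix (m ⊕ q) (m ⊕ q) R} (h : U * V = 1) :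
    U.toBlocks₁₁.det = U.det * V.toBlocks₂₂.det := by
  have h' := h
  rw [← fromBlocks_toBlocks U, ← fromBlocks_toBlocks V, fromBlocks_multiply,
    ← fromBlocks_one, fromBlocks_inj] at h'
  obtain ⟨-, h₁₂, -, h₂₂⟩ := h'
  have key : U * fromBlocks 1 V.toBlocks₁₂ 0 V.toBlocks₂₂
      = fromBlocks U.toBlocks₁₁ 0 U.toBlocks₂₁ 1 := by
    conv_lhs => rw [← fromBlocks_toBlocks U]
    simp [fromBlocks_multiply, h₁₂, h₂₂]
  simpa using (congrArg det key).symm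

/-- Jacobi's identity with one row of the corner block exchanged, for all rows at once. -/
theorem toBlocks₂₁_mul_adjugate {U V : Matrix (m ⊕ q) (m ⊕ q) R} (h : U * V = 1) :
    U.toBlocks₂₁ * adjugate U.toBlocks₁₁
      = -(U.det • (adjugate V.toBlocks₂₂ * V.toBlocks₂₁)) := by
  ext k s
  let σ := Equiv.swap (Sum.inl s : m ⊕ q) (Sum.inr k)
  have hσ : U.submatrix σ id * V.submatrix id σ = 1 := by
    rw [← submatrix_mul _ _ _ _ _ Function.bijective_id, h, submatrix_one_equiv]
  have hdet : (U.submatrix σ id).det = -U.det := by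
    simp [σ, det_permute]
  have h₁₁ : (U.submatrix σ id).toBlocks₁₁ = U.toBlocks₁₁.updateRow s (U.toBlocks₂₁ k) := by
    ext i j
    simp only [toBlocks₁₁, toBlocks₂₁, updateRow_apply, σ, of_apply, submatrix_apply]
    split_ifs with hi
    · simp [hi]
    · rw [Equiv.swap_apply_of_ne_of_ne (by simpa using hi) (by simp), id]
  have h₂₂ : (V.submatrix id σ).toBlocks₂₂
      = V.toBlocks₂₂.updateCol k (fun i => V.toBlocks₂₁ i s) := by
    ext i j
    simp only [toBlocks₂₂, toBlocks₂₁, updateCol_apply, σ, of_apply, submatrix_apply]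
    split_ifs with hj
    · simp [hj]
    · rw [Equiv.swap_apply_of_ne_of_ne (by simp) (by simpa using hj), id]
  have key := det_toBlocks₁₁_eq_of_mul_eq_one hσ
  rw [hdet, h₁₁, h₂₂, ← cramer_transpose_apply, ← cramer_apply, cramer_eq_adjugate_mulVec,
    cramer_eq_adjugate_mulVec, ← adjugate_transpose, mulVec_transpose] at key
  simpa [mul_apply, vecMul, mulVec, dotProduct] using key

/-- The adjugate of a corner block of an invertible matrix in terms of its inverse. -/
theorem adjugate_toBlocks₁₁_eq {U V : Matrix (m ⊕ q) (m ⊕ q) R} (h : U * V = 1) :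
    adjugate U.toBlocks₁₁ = U.det • (V.toBlocks₂₂.det • V.toBlocks₁₁
      - V.toBlocks₁₂ * adjugate V.toBlocks₂₂ * V.toBlocks₂₁) := by
  have h' := mul_eq_one_comm.1 h
  rw [← fromBlocks_toBlocks U, ← fromBlocks_toBlocks V, fromBlocks_multiply,
    ← fromBlocks_one, fromBlocks_inj] at h'
  calc adjugate U.toBlocks₁₁
      = (V.toBlocks₁₁ * U.toBlocks₁₁ + V.toBlocks₁₂ * U.toBlocks₂₁) * adjugate U.toBlocks₁₁ := by
        rw [h'.1, Matrix.one_mul]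
    _ = _ := by
        rw [Matrix.add_mul, Matrix.mul_assoc, mul_adjugate, Matrix.mul_assoc,
          toBlocks₂₁_mul_adjugate h, det_toBlocks₁₁_eq_of_mul_eq_one h]
        simp [mul_smul, sub_eq_add_neg, Matrix.mul_assoc]

end Blocks

theorem finRotate_pow_apply_val {N : ℕ} (p : ℕ) (i : Fin N) :
    ((finRotate N ^ p) i).val = (i.val + p) % N := by
  have := i.neZero
  induction p with
  | zero => simp [Nat.mod_eq_of_lt i.isLt]
  | succ p ih =>
    rw [pow_succ', Equiv.Perm.mul_apply, finRotate_apply, Fin.val_add, ih, Fin.val_one',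
      ← Nat.add_mod, add_assoc]

/-- Row positions of the two blocks of a square matrix of size `n + p`. -/
def rowPos (n p : ℕ) : Fin n ⊕ Fin p → ℕ := Sum.elim (fun j => j) (fun k => n + k)

/-- Column positions of the two blocks, with the last `n` columns listed first. -/
def colPos (n p : ℕ) : Fin n ⊕ Fin p → ℕ := Sum.elim (fun j => p + j) (fun k => k)

/-- The unitriangular Toeplitz matrix of signed elementary symmetric polynomials, with columns
permuted so that its leading block is the banded Toeplitz matrix. -/
noncomputable def elemMatrix (w : ℕ) (z : Fin w → ℂ) (n p : ℕ) :
    Matrix (Fin n ⊕ Fin p) (Fin n ⊕ Fin p) ℂ :=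
  of fun i j => signedE w z ((colPos n p j : ℤ) - rowPos n p i)

/-- The unitriangular Toeplitz matrix of complete homogeneous symmetric polynomials, with rows
permuted as the columns of `elemMatrix`. -/
noncomputable def homogMatrix (w : ℕ) (z : Fin w → ℂ) (n p : ℕ) :
    Matrix (Fin n ⊕ Fin p) (Fin n ⊕ Fin p) ℂ :=
  of fun i j => hInt w z ((rowPos n p j : ℤ) - colPos n p i)

theorem elemMatrix_mul_homogMatrix (w : ℕ) (z : Fin w → ℂ) (n p : ℕ) :
    elemMatrix w z n p * homogMatrix w z n p = 1 := by
  ext i j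
  have hlt : rowPos n p j < p + n := by
    rcases j with j | j <;> simp only [rowPos, Sum.elim_inl, Sum.elim_inr] <;> omega
  have hinj : rowPos n p i = rowPos n p j ↔ i = j := by
    rcases i with i | i <;> rcases j with j | j <;>
      simp only [rowPos, Sum.elim_inl, Sum.elim_inr, Sum.inl.injEq, Sum.inr.injEq, reduceCtorEq,
        Fin.ext_iff, iff_false] <;> omega
  have key := sum_range_signedE_mul_hInt w z (p + n) (rowPos n p i) (rowPos n p j) hlt
  rw [Finset.sum_range_add] at key
  rw [mul_apply, Fintype.sum_sum_type, one_apply, ← if_congr hinj rfl rfl, ← key, add_comm,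
    ← Fin.sum_univ_eq_sum_range, ← Fin.sum_univ_eq_sum_range
      (fun k => signedE w z (((p + k : ℕ) : ℤ) - _) * hInt w z (_ - ((p + k : ℕ) : ℤ)))]
  rfl

theorem det_elemMatrix (w : ℕ) (z : Fin w → ℂ) (n p : ℕ) :
    (elemMatrix w z n p).det = (-1) ^ (p * n) := by
  let U : Matrix (Fin (n + p)) (Fin (n + p)) ℂ := of fun i j => signedE w z ((j : ℤ) - i)
  have hU : U.det = 1 := by
    rw [det_of_isUpperTriangular]
    · simp [U, signedE_zero]
    · intro i j hij
      exact signedE_of_neg w z (by simpa using hij)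
  have h : elemMatrix w z n p
      = (U.submatrix id (finRotate (n + p) ^ p)).submatrix finSumFinEquiv finSumFinEquiv := by
    ext i j
    have hcol : colPos n p j = ((finRotate (n + p) ^ p) (finSumFinEquiv j)).val := by
      rw [finRotate_pow_apply_val]
      rcases j with j | j
      · simp only [colPos, Sum.elim_inl, finSumFinEquiv_apply_left, Fin.val_castAdd]
        rw [Nat.mod_eq_of_lt (by omega), add_comm]
      · simp only [colPos, Sum.elim_inr, finSumFinEquiv_apply_right, Fin.val_natAdd]
        rw [add_right_comm, Nat.add_mod_left, Nat.mod_eq_of_lt (by omega)]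
    have hrow : rowPos n p i = (finSumFinEquiv i).val := by
      rcases i with i | i <;> simp [rowPos]
    simp [elemMatrix, U, hcol, hrow]
  rw [h, det_submatrix_equiv_self, det_permute', hU, mul_one, map_pow, sign_finRotate, ← pow_mul]
  rcases Nat.eq_zero_or_pos p with rfl | hp
  · simp
  · push_cast
    have : (n + p - 1) * p = p * n + p * (p - 1) := by
      rw [Nat.add_sub_assoc hp]; ring
    rw [this, pow_add, (Nat.even_mul_pred_self p).neg_one_pow, mul_one]

theorem det_homogMatrix_toBlocks₂₂ (w : ℕ) (z : Fin w → ℂ) (n p : ℕ) :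
    (homogMatrix w z n p).toBlocks₂₂.det = schur w z p (fun _ => (n : ℤ)) := by
  rw [schur, skewSchur]
  congr 1
  ext i j
  simp only [toBlocks₂₂, homogMatrix, rowPos, colPos, of_apply, Sum.elim_inr]
  congr 1
  push_cast
  ring

/-- Cramer's rule for the Jacobi–Trudi matrix of `(n^p)`: replacing its row `k` and moving the new
row to the bottom gives another Jacobi–Trudi matrix. -/
theorem homogMatrix_toBlocks₁₂_mul_adjugate (w : ℕ) (z : Fin w → ℂ) (n p : ℕ)
    (r : Fin n) (k : Fin p) :
    ((homogMatrix w z n p).toBlocks₁₂ * adjugate (homogMatrix w z n p).toBlocks₂₂) r k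
      = (-1) ^ (p - 1 - k.val) * schur w z p (fun j => if j ≤ k.val then (n : ℤ)
          else if j ≤ p - 1 then (n : ℤ) - 1 else (n : ℤ) - (r.val + 1)) := by
  have := k.neZero
  let Q := (homogMatrix w z n p).toBlocks₂₂
  let v : Fin p → ℂ := (homogMatrix w z n p).toBlocks₁₂ r
  let l : Fin p := ⟨p - 1, by have := k.isLt; omega⟩
  have hkl : k ≤ l := Fin.le_def.2 (by simp only [l]; omega)
  have hcramer : ((homogMatrix w z n p).toBlocks₁₂ * adjugate Q) r k = (Q.updateRow k v).det := by
    rw [← cramer_transpose_apply, cramer_eq_adjugate_mulVec, ← adjugate_transpose,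
      mulVec_transpose]
    rfl
  have hschur : schur w z p (fun j => if j ≤ k.val then (n : ℤ)
          else if j ≤ p - 1 then (n : ℤ) - 1 else (n : ℤ) - (r.val + 1))
      = ((Q.updateRow k v).submatrix (Fin.cycleIcc k l) id).det := by
    rw [schur, skewSchur]
    congr 1
    ext i j
    rw [submatrix_apply, updateRow_apply]
    rcases lt_or_ge i k with hik | hik
    · rw [Fin.cycleIcc_of_lt hik, if_neg hik.ne]
      simp only [Q, toBlocks₂₂, homogMatrix, rowPos, colPos, of_apply, Sum.elim_inr, id]
      rw [if_pos (by omega)]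
      congr 1
      push_cast
      ring
    · have hil : i ≤ l := Fin.le_def.2 (by simp only [l]; omega)
      rw [Fin.cycleIcc_of_le_of_le hik hil]
      rw [Fin.le_def] at hik
      by_cases hl : i = l
      · have hl' : i.val = p - 1 := congrArg Fin.val hl
        rw [if_pos hl, if_pos rfl]
        simp only [v, toBlocks₁₂, homogMatrix, rowPos, colPos, of_apply, Sum.elim_inr,
          Sum.elim_inl, id]
        rw [if_neg (by omega), if_neg (by omega)]
        congr 1
        push_cast
        omega
      · have hl' : i.val ≠ p - 1 := fun h => hl (Fin.ext h)
        have hv : (i + 1).val = i.val + 1 := Fin.val_add_one_of_lt' (by omega)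
        rw [if_neg hl, if_neg (fun h => by have := congrArg Fin.val h; omega)]
        simp only [Q, toBlocks₂₂, homogMatrix, rowPos, colPos, of_apply, Sum.elim_inr, id]
        rw [if_neg (by omega), if_pos (by omega), hv]
        congr 1
        push_cast
        ring
  rw [hcramer, hschur, det_permute, Fin.sign_cycleIcc_of_le hkl, ← mul_assoc]
  simp [l, ← mul_pow]

theorem toeplitz_aCoeff_eq_smul (w p : ℕ) (ap : ℂ) (z : Fin w → ℂ) (n : ℕ) :
    toeplitz n (aCoeff w p ap z) = ap • (elemMatrix w z n p).toBlocks₁₁ := by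
  ext i j
  simp only [toeplitz, aCoeff, toBlocks₁₁, elemMatrix, signedE, rowPos, colPos, of_apply,
    Sum.elim_inl, Matrix.smul_apply, smul_eq_mul, Nat.cast_add]
  rw [show (p : ℤ) - (i - j) = p + j - i by ring]
  ring

/-- Theorem 2, formula (eq:Trench):
`adj(T_n(a))_{r,s} = (-1)^{pn} a_p^{n-1} ( h_{s-r-p} s_{(n^p)}
  - Σ_{k=0}^{p-1} (-1)^k h_{s+k-p} s_{(n^{p-k-1},(n-1)^k, n-r)} )`. -/
theorem toeplitz_adjugate_trench
    (w : ℕ) (hw : 1 ≤ w) (z : Fin w → ℂ) (p : ℕ) (ap : ℂ) (hap : ap ≠ 0)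
    (n : ℕ) (hn : 1 ≤ n) (r s : ℕ) (hr : 1 ≤ r) (hrn : r ≤ n) (hs : 1 ≤ s) (hsn : s ≤ n) :
    Matrix.adjugate (toeplitz n (aCoeff w p ap z)) ⟨r - 1, by omega⟩ ⟨s - 1, by omega⟩
      = (-1 : ℂ) ^ (p * n) * ap ^ (n - 1)
        * (hInt w z ((s : ℤ) - (r : ℤ) - (p : ℤ)) * schur w z p (fun _ => (n : ℤ))
           - ∑ k ∈ Finset.range p, (-1 : ℂ) ^ k * hInt w z ((s : ℤ) + (k : ℤ) - (p : ℤ))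
               * schur w z p
                   (fun j => if j ≤ p - k - 1 then (n : ℤ)
                     else if j ≤ p - 1 then (n : ℤ) - 1 else (n : ℤ) - (r : ℤ))) := by
  have h := congrFun₂ (adjugate_toBlocks₁₁_eq (elemMatrix_mul_homogMatrix w z n p))
    ⟨r - 1, by omega⟩ ⟨s - 1, by omega⟩
  rw [toeplitz_aCoeff_eq_smul, adjugate_smul, Matrix.smul_apply, h, Fintype.card_fin, smul_eq_mul,
    Matrix.smul_apply, smul_eq_mul, det_elemMatrix, det_homogMatrix_toBlocks₂₂,
    Matrix.sub_apply, Matrix.smul_apply,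
    smul_eq_mul, mul_apply, mul_left_comm, ← mul_assoc,
    ← Fin.sum_univ_eq_sum_range (fun k => (-1 : ℂ) ^ k * hInt w z ((s : ℤ) + (k : ℤ) - (p : ℤ))
      * schur w z p (fun j => if j ≤ p - k - 1 then (n : ℤ)
          else if j ≤ p - 1 then (n : ℤ) - 1 else (n : ℤ) - (r : ℤ))),
    ← Equiv.sum_comp Fin.revPerm]
  congr 2
  · rw [mul_comm]
    simp only [toBlocks₁₁, homogMatrix, rowPos, colPos, of_apply, Sum.elim_inl]
    congr 2
    push_cast [hr, hs]
    ring
  · refine Finset.sum_congr rfl fun k _ => ?_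
    rw [homogMatrix_toBlocks₁₂_mul_adjugate, mul_right_comm]
    simp only [toBlocks₂₁, homogMatrix, rowPos, colPos, of_apply, Sum.elim_inl, Sum.elim_inr,
      Fin.revPerm_apply, Fin.val_rev]
    have hk := k.isLt
    rw [show p - (k.val + 1) = p - 1 - k.val by omega,
      show p - 1 - (p - 1 - k.val) = k.val by omega,
      show p - k.val - 1 = p - 1 - k.val by omega,
      show ((r - 1 : ℕ) : ℤ) + 1 = r by omega,
      show (s : ℤ) + k.val - p = ((s - 1 : ℕ) : ℤ) - ((p - 1 - k.val : ℕ) : ℤ) by omega]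
end
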